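/- The relations R_AS completed with the torsion relations S_α² = 1 make a presentation of the group 𝔖• = G(A,S) (the geometry group of associativity and semi-commutativity) in terms of the generators A_α and S_α: the canonical homomorphism from the group presented by generators {A_α, S_α : α an address} and these relations to G(A,S) is an isomorphism. -/

import Mathlib

/-- Coloured trees: finite rooted binary trees whose leaves are labelled by
positive integers. -/
inductive CTree : Type
  | leaf : ℕ+ → CTree
  | node : CTree → CTree → CTree

/-- Partial maps on coloured trees, as a monoid under reversed composition:
`(f * g) t = (f t).bind g`, i.e. `f * g` means "`f` then `g`". -/
abbrev PMap : Type := CTree → Option CTree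

instance : Monoid PMap where
  one := fun t => some t
  mul f g := fun t => (f t).bind g
  mul_assoc f g h := by
    funext t
    show ((f t).bind g).bind h = (f t).bind fun u => (g u).bind h
    cases f t <;> rfl
  one_mul f := rfl
  mul_one f := by
    funext t
    show (f t).bind some = f t
    cases f t <;> rfl

/-- The associativity operator `A`: maps `t₁·(t₂·t₃)` to `(t₁·t₂)·t₃`. -/
def opA : PMap
  | .node t₁ (.node t₂ t₃) => some (.node (.node t₁ t₂) t₃)
  | _ => none

/-- The inverse partial map of `A`: maps `(t₁·t₂)·t₃` to `t₁·(t₂·t₃)`. -/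
def opAi : PMap
  | .node (.node t₁ t₂) t₃ => some (.node t₁ (.node t₂ t₃))
  | _ => none

/-- The commutativity operator `C`: maps `t₁·t₂` to `t₂·t₁` (its own inverse
as a partial map). -/
def opC : PMap
  | .node t₁ t₂ => some (.node t₂ t₁)
  | _ => none

/-- The semi-commutativity operator `S`: maps `t₁·(t₂·t₃)` to `t₂·(t₁·t₃)`
(its own inverse as a partial map). -/
def opS : PMap
  | .node t₁ (.node t₂ t₃) => some (.node t₂ (.node t₁ t₃))
  | _ => none

/-- Addresses: finite words over `{0,1}`, with `false` = 0 (left) and `true` = 1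
(right). -/
abbrev Addr := List Bool

/-- `applyAt α f` is the shifted operator `∂_α f`, applying `f` to the
`α`-subtree of its argument. -/
def applyAt : Addr → PMap → PMap
  | [], f => f
  | false :: α, f => fun t => match t with
      | .node t₁ t₂ => (applyAt α f t₁).map (fun s => .node s t₂)
      | _ => none
  | true :: α, f => fun t => match t with
      | .node t₁ t₂ => (applyAt α f t₂).map (fun s => .node t₁ s)
      | _ => none

/-- Two partial maps are near-equal if they are both defined on at least one common
element, and they agree wherever both are defined. -/
def NearEq (f g : PMap) : Prop :=
  (∃ t, (f t).isSome ∧ (g t).isSome) ∧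
  ∀ t, (f t).isSome → (g t).isSome → f t = g t

/-- The generators of the geometry monoid `𝒢(A,S)`: the operators `A_α`, `S_α`
and their inverse partial maps (`S_α` is its own inverse). -/
def genAS : Set PMap :=
  {f | ∃ α : Addr, f = applyAt α opA ∨ f = applyAt α opAi ∨ f = applyAt α opS}

/-- The geometry monoid `𝒢(A,S)` of associativity and semi-commutativity. -/
def GeoAS : Submonoid PMap := Submonoid.closure genAS

theorem memA (α : Addr) : applyAt α opA ∈ GeoAS :=
  Submonoid.subset_closure ⟨α, Or.inl rfl⟩

theorem memS (α : Addr) : applyAt α opS ∈ GeoAS :=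
  Submonoid.subset_closure ⟨α, Or.inr (Or.inr rfl)⟩

/-- Formal generators `A_α`, `S_α`. -/
inductive GenAS : Type
  | A : Addr → GenAS
  | S : Addr → GenAS

/-- `fX b α` is `A_α` for `b = false` and `S_α` for `b = true`. -/
def fX : Bool → Addr → FreeGroup GenAS
  | false, α => FreeGroup.of (GenAS.A α)
  | true, α => FreeGroup.of (GenAS.S α)

def fA (α : Addr) : FreeGroup GenAS := FreeGroup.of (GenAS.A α)
def fS (α : Addr) : FreeGroup GenAS := FreeGroup.of (GenAS.S α)

/-- The relations `R_AS` together with the torsion relations `S_α² = 1`, as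
relators: for `X, Y` ranging over `{A, S}` and all addresses `α, β, γ`:
`X_{γ0α}·Y_{γ1β} = Y_{γ1β}·X_{γ0α}`; `X_{γ11α}·A_γ = A_γ·X_{γ1α}`,
`X_{γ10α}·A_γ = A_γ·X_{γ01α}`, `X_{γ0α}·A_γ = A_γ·X_{γ00α}`;
`X_{γ11α}·S_γ = S_γ·X_{γ11α}`, `X_{γ10α}·S_γ = S_γ·X_{γ0α}`,
`X_{γ0α}·S_γ = S_γ·X_{γ10α}`; the pentagon relations `A_γ·A_γ = A_{γ1}·A_γ·A_{γ0}`;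
`S_γ·A_{γ1}·A_γ = A_{γ1}·A_γ·S_{γ0}`, `S_{γ1}·S_γ·A_{γ1} = A_γ·S_γ`,
`S_γ·S_{γ1}·A_γ = A_{γ1}·S_γ`, `S_γ·S_{γ1}·S_γ = S_{γ1}·S_γ·S_{γ1}`; and
`S_γ·S_γ = 1`. -/
def relsAS : Set (FreeGroup GenAS) :=
  {x | ∃ γ : Addr,
    (∃ (b b' : Bool) (α β : Addr),
      x = fX b (γ ++ false :: α) * fX b' (γ ++ true :: β) *
          (fX b' (γ ++ true :: β) * fX b (γ ++ false :: α))⁻¹) ∨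
    (∃ (b : Bool) (α : Addr),
      x = fX b (γ ++ true :: true :: α) * fA γ * (fA γ * fX b (γ ++ true :: α))⁻¹) ∨
    (∃ (b : Bool) (α : Addr),
      x = fX b (γ ++ true :: false :: α) * fA γ *
          (fA γ * fX b (γ ++ false :: true :: α))⁻¹) ∨
    (∃ (b : Bool) (α : Addr),
      x = fX b (γ ++ false :: α) * fA γ * (fA γ * fX b (γ ++ false :: false :: α))⁻¹) ∨
    (∃ (b : Bool) (α : Addr),
      x = fX b (γ ++ true :: true :: α) * fS γ * (fS γ * fX b (γ ++ true :: true :: α))⁻¹) ∨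
    (∃ (b : Bool) (α : Addr),
      x = fX b (γ ++ true :: false :: α) * fS γ * (fS γ * fX b (γ ++ false :: α))⁻¹) ∨
    (∃ (b : Bool) (α : Addr),
      x = fX b (γ ++ false :: α) * fS γ * (fS γ * fX b (γ ++ true :: false :: α))⁻¹) ∨
    (x = fA γ * fA γ * (fA (γ ++ [true]) * fA γ * fA (γ ++ [false]))⁻¹) ∨
    (x = fS γ * fA (γ ++ [true]) * fA γ * (fA (γ ++ [true]) * fA γ * fS (γ ++ [false]))⁻¹) ∨
    (x = fS (γ ++ [true]) * fS γ * fA (γ ++ [true]) * (fA γ * fS γ)⁻¹) ∨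
    (x = fS γ * fS (γ ++ [true]) * fA γ * (fA (γ ++ [true]) * fS γ)⁻¹) ∨
    (x = fS γ * fS (γ ++ [true]) * fS γ * (fS (γ ++ [true]) * fS γ * fS (γ ++ [true]))⁻¹) ∨
    (x = fS γ * fS γ)}

section Helpers

/-! ### The relations in the presented group -/

abbrev PG : Type := PresentedGroup relsAS

def pX (b : Bool) (α : Addr) : PG := PresentedGroup.mk relsAS (fX b α)

theorem pg_rel {x y : FreeGroup GenAS} (h : x * y⁻¹ ∈ relsAS) :
    PresentedGroup.mk relsAS x = PresentedGroup.mk relsAS y := by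
  have := PresentedGroup.one_of_mem h
  rw [map_mul, map_inv, mul_inv_eq_one] at this
  exact this

theorem rel_A11 (γ : Addr) (b : Bool) (α : Addr) :
    pX b (γ ++ true :: true :: α) * pX false γ = pX false γ * pX b (γ ++ true :: α) := by
  simp only [pX, ← map_mul]
  exact pg_rel ⟨γ, Or.inr (Or.inl ⟨b, α, rfl⟩)⟩

theorem rel_A10 (γ : Addr) (b : Bool) (α : Addr) :
    pX b (γ ++ true :: false :: α) * pX false γ
      = pX false γ * pX b (γ ++ false :: true :: α) := by
  simp only [pX, ← map_mul]
  exact pg_rel ⟨γ, Or.inr (Or.inr (Or.inl ⟨b, α, rfl⟩))⟩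

theorem rel_A0 (γ : Addr) (b : Bool) (α : Addr) :
    pX b (γ ++ false :: α) * pX false γ = pX false γ * pX b (γ ++ false :: false :: α) := by
  simp only [pX, ← map_mul]
  exact pg_rel ⟨γ, Or.inr (Or.inr (Or.inr (Or.inl ⟨b, α, rfl⟩)))⟩

theorem rel_S11 (γ : Addr) (b : Bool) (α : Addr) :
    pX b (γ ++ true :: true :: α) * pX true γ
      = pX true γ * pX b (γ ++ true :: true :: α) := by
  simp only [pX, ← map_mul]
  exact pg_rel ⟨γ, Or.inr (Or.inr (Or.inr (Or.inr (Or.inl ⟨b, α, rfl⟩))))⟩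

theorem rel_pent (γ : Addr) :
    pX false γ * pX false γ
      = pX false (γ ++ [true]) * pX false γ * pX false (γ ++ [false]) := by
  simp only [pX, ← map_mul]
  refine pg_rel ⟨γ, ?_⟩
  iterate 7 right
  left; rfl

theorem rel_SAA (γ : Addr) :
    pX true γ * pX false (γ ++ [true]) * pX false γ
      = pX false (γ ++ [true]) * pX false γ * pX true (γ ++ [false]) := by
  simp only [pX, ← map_mul]
  refine pg_rel ⟨γ, ?_⟩
  iterate 8 right
  left; rfl

theorem rel_SSA1 (γ : Addr) :
    pX true (γ ++ [true]) * pX true γ * pX false (γ ++ [true]) = pX false γ * pX true γ := by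
  simp only [pX, ← map_mul]
  refine pg_rel ⟨γ, ?_⟩
  iterate 9 right
  left; rfl

theorem rel_SSA (γ : Addr) :
    pX true γ * pX true (γ ++ [true]) * pX false γ = pX false (γ ++ [true]) * pX true γ := by
  simp only [pX, ← map_mul]
  refine pg_rel ⟨γ, ?_⟩
  iterate 10 right
  left; rfl

theorem rel_braid (γ : Addr) :
    pX true γ * pX true (γ ++ [true]) * pX true γ
      = pX true (γ ++ [true]) * pX true γ * pX true (γ ++ [true]) := by
  simp only [pX, ← map_mul]
  refine pg_rel ⟨γ, ?_⟩
  iterate 11 right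
  left; rfl

theorem rel_SS (γ : Addr) : pX true γ * pX true γ = 1 := by
  simp only [pX, ← map_mul]
  refine PresentedGroup.one_of_mem ⟨γ, ?_⟩
  iterate 12 right
  rfl

/-- The address `1^k`. -/
def rr (k : ℕ) : Addr := List.replicate k true

theorem rr_succ (k : ℕ) : rr (k + 1) = rr k ++ [true] := List.replicate_succ'

theorem rr_add (k m : ℕ) (α : Addr) : rr (k + m) ++ α = rr k ++ (rr m ++ α) := by
  rw [rr, List.replicate_add, List.append_assoc]; rfl

def sS (k : ℕ) : PG := pX true (rr k)
def aA (k : ℕ) : PG := pX false (rr k)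

theorem comm_S {i j : ℕ} (h : i + 2 ≤ j) (b : Bool) (α : Addr) :
    pX b (rr j ++ α) * sS i = sS i * pX b (rr j ++ α) := by
  obtain ⟨m, rfl⟩ := Nat.exists_eq_add_of_le h
  have := rel_S11 (rr i) b (rr m ++ α)
  rw [add_assoc, rr_add, add_comm 2 m]
  exact this

theorem comm_A {i j : ℕ} (h : i + 1 ≤ j) (b : Bool) (α : Addr) :
    pX b (rr (j + 1) ++ α) * aA i = aA i * pX b (rr j ++ α) := by
  obtain ⟨m, rfl⟩ := Nat.exists_eq_add_of_le h
  have := rel_A11 (rr i) b (rr m ++ α)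
  rw [show i + 1 + m + 1 = i + (m + 2) by ring, show i + 1 + m = i + (m + 1) by ring,
    rr_add i, rr_add i]
  exact this

theorem comm_A' {i j : ℕ} (h : i + 1 ≤ j) (b : Bool) :
    (aA i)⁻¹ * pX b (rr (j + 1)) = pX b (rr j) * (aA i)⁻¹ := by
  have := comm_A h b []
  rw [List.append_nil, List.append_nil] at this
  rw [inv_mul_eq_iff_eq_mul, ← mul_assoc, ← this, mul_inv_cancel_right]

theorem sS_comm {i j : ℕ} (h : i + 2 ≤ j) : sS j * sS i = sS i * sS j := by
  have := comm_S h true []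
  rwa [List.append_nil] at this

theorem aA_sS_comm {i j : ℕ} (h : i + 2 ≤ j) : aA j * sS i = sS i * aA j := by
  have := comm_S h false []
  rwa [List.append_nil] at this

theorem sS_sq (i : ℕ) : sS i * sS i = 1 := rel_SS _

theorem sS_braid (i : ℕ) : sS i * sS (i + 1) * sS i = sS (i + 1) * sS i * sS (i + 1) := by
  have := rel_braid (rr i)
  rwa [← rr_succ] at this

/-! ### Sorting -/

def oi (a : ℕ+) : List ℕ+ → List ℕ+
  | [] => [a]
  | b :: M => if a < b then a :: b :: M else b :: oi a M

def isort : List ℕ+ → List ℕ+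
  | [] => []
  | a :: L => oi a (isort L)

def ins : ℕ → ℕ+ → List ℕ+ → PG
  | _, _, [] => 1
  | k, a, b :: M => if a < b then 1 else sS k * ins (k + 1) a M

def sig : ℕ → List ℕ+ → PG
  | _, [] => 1
  | k, a :: L => sig (k + 1) L * ins k a (isort L)

theorem oi_comm (a b : ℕ+) (M : List ℕ+) : oi a (oi b M) = oi b (oi a M) := by
  induction M with
  | nil =>
    rcases lt_trichotomy a b with h | h | h
    · simp [oi, h, h.not_gt]
    · simp [h]
    · simp [oi, h, h.not_gt]
  | cons m M ih =>
    by_cases ha : a < m <;> by_cases hb : b < m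
    · rcases lt_trichotomy a b with h | h | h
      · simp [oi, h, h.not_gt, ha, hb]
      · simp [h]
      · simp [oi, h, h.not_gt, ha, hb]
    · have h : a < b := lt_of_lt_of_le ha (not_lt.mp hb)
      simp [oi, ha, hb, h, h.not_gt]
    · have h : b < a := lt_of_lt_of_le hb (not_lt.mp ha)
      simp [oi, ha, hb, h, h.not_gt]
    · simp [oi, ha, hb, ih]

theorem isort_swap (us : List ℕ+) (a b : ℕ+) (L : List ℕ+) :
    isort (us ++ a :: b :: L) = isort (us ++ b :: a :: L) := by
  induction us with
  | nil => simp [isort, oi_comm a b]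
  | cons c us ih => simp [isort, ih]

theorem ins_comm {i k : ℕ} (h : i + 2 ≤ k) (a : ℕ+) (M : List ℕ+) :
    ins k a M * sS i = sS i * ins k a M := by
  induction M generalizing k with
  | nil => simp [ins]
  | cons b M ih =>
    unfold ins
    split_ifs
    · simp
    · rw [mul_assoc, ih (by omega), ← mul_assoc, sS_comm h, mul_assoc]

theorem sig_comm {i k : ℕ} (h : i + 2 ≤ k) (L : List ℕ+) :
    sig k L * sS i = sS i * sig k L := by
  induction L generalizing k with
  | nil => simp [sig]
  | cons a L ih =>
    unfold sig
    rw [mul_assoc, ins_comm h, ← mul_assoc, ih (by omega), mul_assoc]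

theorem ins_swap (k : ℕ) (a b : ℕ+) (hab : a ≠ b) (M : List ℕ+) :
    sS k * (ins (k + 1) a M * ins k b (oi a M)) = ins (k + 1) b M * ins k a (oi b M) := by
  induction M generalizing k with
  | nil =>
    rcases lt_or_gt_of_ne hab with h | h
    · simp [oi, ins, h, h.not_gt, sS_sq]
    · simp [oi, ins, h, h.not_gt]
  | cons m M ih =>
    by_cases ha : a < m <;> by_cases hb : b < m
    · rcases lt_or_gt_of_ne hab with h | h
      · simp [oi, ins, h, h.not_gt, ha, hb, sS_sq]
      · simp [oi, ins, h, h.not_gt, ha, hb]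
    · have h : a < b := lt_of_lt_of_le ha (not_lt.mp hb)
      simp [oi, ins, ha, hb, h.not_gt]
      rw [← mul_assoc, sS_sq, one_mul]
    · have h : b < a := lt_of_lt_of_le hb (not_lt.mp ha)
      simp [oi, ins, ha, hb, h.not_gt]
    · simp only [oi, ins, ha, hb, if_false]
      have e1 := ih (k + 1)
      have c1 := ins_comm (le_refl (k + 2)) a M
      have c2 := ins_comm (le_refl (k + 2)) b M
      have e2 : ins (k + 1 + 1) a M * ins (k + 1) b (oi a M)
          = sS (k + 1) * (ins (k + 1 + 1) b M * ins (k + 1) a (oi b M)) := by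
        rw [← e1, ← mul_assoc, sS_sq, one_mul]
      calc sS k * (sS (k + 1) * ins (k + 1 + 1) a M * (sS k * ins (k + 1) b (oi a M)))
          = sS k * sS (k + 1) * (ins (k + 1 + 1) a M * sS k) * ins (k + 1) b (oi a M) := by
            group
        _ = sS k * sS (k + 1) * sS k * (ins (k + 1 + 1) a M * ins (k + 1) b (oi a M)) := by
            rw [c1]; group
        _ = sS (k + 1) * sS k * (sS (k + 1) * sS (k + 1))
              * (ins (k + 1 + 1) b M * ins (k + 1) a (oi b M)) := by
            rw [e2, sS_braid]; group
        _ = sS (k + 1) * (sS k * ins (k + 1 + 1) b M) * ins (k + 1) a (oi b M) := by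
            rw [sS_sq]; group
        _ = _ := by rw [← c2]; group

theorem sig_swap (k : ℕ) (us : List ℕ+) (a b : ℕ+) (hab : a ≠ b) (L : List ℕ+) :
    sig k (us ++ a :: b :: L) = sS (k + us.length) * sig k (us ++ b :: a :: L) := by
  induction us generalizing k with
  | nil =>
    simp only [List.nil_append, sig, isort, List.length_nil, add_zero]
    have e := (ins_swap k a b hab (isort L)).symm
    have c := sig_comm (le_refl (k + 2)) L
    rw [mul_assoc, e, ← mul_assoc, mul_assoc (sig _ _) (ins _ _ _), ← mul_assoc (sS k) (sig _ _)]
    exact congrArg (· * _) c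
  | cons c us ih =>
    simp only [List.cons_append, sig, List.length_cons]
    rw [isort_swap us a b, ih, show k + 1 + us.length = k + (us.length + 1) by ring, mul_assoc]

/-! ### Normalizing forests -/

def wt : CTree → ℕ
  | .leaf _ => 1
  | .node a b => wt a + wt b + 1

def wts : List CTree → ℕ
  | [] => 0
  | t :: ts => wt t + wts ts

def lv : CTree → List ℕ+
  | .leaf x => [x]
  | .node a b => lv a ++ lv b

def lvs : List CTree → List ℕ+
  | [] => []
  | t :: ts => lv t ++ lvs ts

theorem lvs_append (us ts : List CTree) : lvs (us ++ ts) = lvs us ++ lvs ts := by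
  induction us with
  | nil => rfl
  | cons u us ih => simp [lvs, ih]

def FF : List ℕ+ → List CTree → PG
  | xs, [] => sig 0 xs
  | xs, .leaf x :: ts => FF (xs ++ [x]) ts
  | xs, .node a b :: ts => (aA xs.length)⁻¹ * FF xs (a :: b :: ts)
termination_by _ ts => wts ts
decreasing_by
  · simp [wts, wt]
  · simp only [wts, wt]; omega

theorem FF_assoc (us : List CTree) (xs : List ℕ+) (a b : CTree) (ts : List CTree) :
    FF xs (us ++ .node a b :: ts)
      = (aA (xs.length + us.length))⁻¹ * FF xs (us ++ a :: b :: ts) := by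
  match us with
  | [] => simp [FF]
  | .leaf x :: us =>
    have := FF_assoc us (xs ++ [x]) a b ts
    simp only [List.cons_append, FF, this, List.length_append, List.length_cons,
      List.length_nil]
    congr 3
    ring
  | .node c d :: us =>
    have := FF_assoc (c :: d :: us) xs a b ts
    simp only [List.cons_append, FF] at this ⊢
    rw [this]
    have h := comm_A' (i := xs.length) (j := xs.length + (us.length + 1)) (by omega) false
    simp only [List.length_cons]
    have h' : (aA xs.length)⁻¹ * (aA (xs.length + (us.length + 1) + 1))⁻¹
        = (aA (xs.length + (us.length + 1)))⁻¹ * (aA xs.length)⁻¹ := by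
      have h2 := comm_A (i := xs.length) (j := xs.length + (us.length + 1)) (by omega) false []
      rw [List.append_nil, List.append_nil] at h2
      rw [← mul_inv_rev, ← mul_inv_rev]
      exact congrArg _ h2
    rw [← mul_assoc, ← mul_assoc, ← h']
    rfl
termination_by wts us
decreasing_by
  · simp [wts, wt]
  · simp only [wts, wt]; omega

/-- Swapping two adjacent labels. -/
theorem FF_swap_label (ts : List CTree) (us vs : List ℕ+) (x y : ℕ+) (hxy : x ≠ y) :
    FF (us ++ x :: y :: vs) ts = sS us.length * FF (us ++ y :: x :: vs) ts := by
  match ts with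
  | [] =>
    have := sig_swap 0 us x y hxy vs
    simpa [FF] using this
  | .leaf z :: ts =>
    have := FF_swap_label ts us (vs ++ [z]) x y hxy
    simpa [FF] using this
  | .node c d :: ts =>
    have := FF_swap_label (c :: d :: ts) us vs x y hxy
    simp only [FF]
    rw [this, ← mul_assoc, ← mul_assoc]
    congr 1
    have h := aA_sS_comm (i := us.length) (j := (us ++ x :: y :: vs).length) (by simp)
    rw [inv_mul_eq_iff_eq_mul, ← mul_assoc,
      show (us ++ y :: x :: vs).length = (us ++ x :: y :: vs).length by simp, h,
      mul_inv_cancel_right]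
termination_by wts ts
decreasing_by
  · simp [wts, wt]
  · simp only [wts, wt]; omega

theorem FF_swap_cons {a b : CTree} {ts : List CTree}
    (H0 : ∀ xs : List ℕ+, (xs ++ lv a ++ lv b).Nodup →
      FF xs (a :: b :: ts) = sS xs.length * FF xs (b :: a :: ts))
    (us : List CTree) (xs : List ℕ+) (hn : (xs ++ lvs us ++ lv a ++ lv b).Nodup) :
    FF xs (us ++ a :: b :: ts)
      = sS (xs.length + us.length) * FF xs (us ++ b :: a :: ts) := by
  match us with
  | [] => simpa using H0 xs (by simpa [lvs] using hn)
  | .leaf x :: us =>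
    have := FF_swap_cons H0 us (xs ++ [x]) (by simpa [lvs, lv] using hn)
    simp only [List.cons_append, FF, this, List.length_append, List.length_cons,
      List.length_nil]
    congr 2
    ring
  | .node c d :: us =>
    have := FF_swap_cons H0 (c :: d :: us) xs (by simpa [lvs, lv] using hn)
    simp only [List.cons_append, FF] at this ⊢
    rw [this]
    have h := comm_A' (i := xs.length) (j := xs.length + (us.length + 1)) (by omega) true
    simp only [List.length_cons]
    rw [← mul_assoc, ← mul_assoc]
    exact congrArg (· * _) h
termination_by wts us
decreasing_by
  · simp [wts, wt]
  · simp only [wts, wt]; omega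

theorem aux_SSA1 (k : ℕ) : (aA k)⁻¹ * sS (k + 1) * sS k = sS k * (aA (k + 1))⁻¹ := by
  have := rel_SSA1 (rr k)
  rw [← rr_succ] at this
  change sS (k + 1) * sS k * aA (k + 1) = aA k * sS k at this
  rw [eq_mul_inv_iff_mul_eq, mul_assoc, mul_assoc, inv_mul_eq_iff_eq_mul, ← this, mul_assoc]

theorem aux_SSA (k : ℕ) : (aA (k + 1))⁻¹ * sS k * sS (k + 1) = sS k * (aA k)⁻¹ := by
  have := rel_SSA (rr k)
  rw [← rr_succ] at this
  change sS k * sS (k + 1) * aA k = aA (k + 1) * sS k at this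
  rw [eq_mul_inv_iff_mul_eq, mul_assoc, mul_assoc, inv_mul_eq_iff_eq_mul, ← this, mul_assoc]

theorem FF_swap0 (a b : CTree) (ts : List CTree) (xs : List ℕ+)
    (hn : (xs ++ lv a ++ lv b).Nodup) :
    FF xs (a :: b :: ts) = sS xs.length * FF xs (b :: a :: ts) := by
  match a, b with
  | .leaf x, .leaf y =>
    have hxy : x ≠ y := by
      rintro rfl
      simp [lv, List.nodup_append] at hn
    have := FF_swap_label ts xs [] x y hxy
    simpa [FF] using this
  | .node c d, b =>
    have hperm : (xs ++ lv (.node c d) ++ lv b).Perm (xs ++ lv c ++ lv b ++ lv d) := by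
      simp only [lv, List.append_assoc]
      exact (List.perm_append_comm.append_left _).append_left _
    have n1 : (xs ++ lvs [c] ++ lv d ++ lv b).Nodup := by simpa [lvs, lv] using hn
    have n2 : (xs ++ lv c ++ lv b).Nodup :=
      (hperm.nodup_iff.mp hn).sublist (List.sublist_append_left _ _)
    have h1 := FF_swap_cons (a := d) (b := b) (ts := ts)
      (fun xs h => FF_swap0 d b ts xs h) [c] xs n1
    have h2 := FF_swap0 c b (d :: ts) xs n2
    have h3 := FF_assoc [b] xs c d ts
    simp only [List.cons_append, List.nil_append, List.length_cons, List.length_nil,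
      zero_add] at h1 h3
    rw [FF, h1, h2, h3, ← mul_assoc, ← mul_assoc, ← mul_assoc, aux_SSA1]
  | .leaf x, .node c d =>
    have n2 : (xs ++ lv (.leaf x) ++ lv c).Nodup := by
      refine hn.sublist ?_
      simp [lv]
    have hperm : (xs ++ lv (.leaf x) ++ lv (.node c d)).Perm
        (xs ++ lv c ++ lv (.leaf x) ++ lv d) := by
      simp only [lv, List.append_assoc]
      refine List.Perm.append_left _ ?_
      rw [← List.append_assoc, ← List.append_assoc (lv c)]
      exact List.perm_append_comm.append_right _
    have n1 : (xs ++ lvs [c] ++ lv (.leaf x) ++ lv d).Nodup := by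
      simpa [lvs] using hperm.nodup_iff.mp hn
    have h1 := FF_swap_cons (a := .leaf x) (b := d) (ts := ts)
      (fun xs h => FF_swap0 (.leaf x) d ts xs h) [c] xs n1
    have h2 := FF_swap0 (.leaf x) c (d :: ts) xs n2
    have h3 := FF_assoc [.leaf x] xs c d ts
    simp only [List.cons_append, List.nil_append, List.length_cons, List.length_nil,
      zero_add] at h1 h3
    rw [h3, h2, h1, FF, ← mul_assoc, ← mul_assoc, ← mul_assoc, aux_SSA]
termination_by wt a + wt b
decreasing_by
  all_goals simp only [wt]; omega

theorem FF_swap (us : List CTree) (xs : List ℕ+) (a b : CTree) (ts : List CTree)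
    (hn : (xs ++ lvs us ++ lv a ++ lv b).Nodup) :
    FF xs (us ++ a :: b :: ts)
      = sS (xs.length + us.length) * FF xs (us ++ b :: a :: ts) :=
  FF_swap_cons (fun xs h => FF_swap0 a b ts xs h) us xs hn

def opX : Bool → PMap
  | false => opA
  | true => opS

theorem opX_perm {b : Bool} {β : Addr} {t t' : CTree} (h : applyAt β (opX b) t = some t') :
    (lv t').Perm (lv t) := by
  induction β generalizing t t' with
  | nil =>
    cases b
    · rcases t with _ | ⟨t1, _ | ⟨t2, t3⟩⟩ <;> simp [applyAt, opX, opA] at h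
      subst h; simp [lv]
    · rcases t with _ | ⟨t1, _ | ⟨t2, t3⟩⟩ <;> simp [applyAt, opX, opS] at h
      subst h
      simp only [lv]
      rw [← List.append_assoc, ← List.append_assoc]
      exact List.perm_append_comm.append_right _
  | cons c β ih =>
    rcases t with _ | ⟨t1, t2⟩
    · cases c <;> simp [applyAt] at h
    · cases c
      · simp [applyAt] at h
        obtain ⟨s, hs, rfl⟩ := h
        exact (ih hs).append_right _
      · simp [applyAt] at h
        obtain ⟨s, hs, rfl⟩ := h
        exact (ih hs).append_left _

/-- A generator acting inside an element of the forest. -/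
theorem FF_inner (b : Bool) (β : Addr) (us : List CTree) (t t' : CTree) (ts : List CTree)
    (hn : (lvs us ++ lv t).Nodup) (h : applyAt β (opX b) t = some t') :
    FF [] (us ++ t :: ts) = pX b (rr us.length ++ false :: β) * FF [] (us ++ t' :: ts) := by
  have key : ∀ t1 t2, FF [] (us ++ .node t1 t2 :: ts)
      = (aA us.length)⁻¹ * FF [] (us ++ t1 :: t2 :: ts) := by
    intro t1 t2
    simpa using FF_assoc us [] t1 t2 ts
  induction β generalizing us t t' ts with
  | nil =>
    rcases t with _ | ⟨t1, _ | ⟨t2, t3⟩⟩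
    · cases b <;> simp [applyAt, opX, opS, opA] at h
    · cases b <;> simp [applyAt, opX, opS, opA] at h
    have k2 : ∀ t1 t2 t3, FF [] (us ++ t1 :: .node t2 t3 :: ts)
        = (aA (us.length + 1))⁻¹ * FF [] (us ++ t1 :: t2 :: t3 :: ts) := by
      intro t1 t2 t3
      simpa using FF_assoc (us ++ [t1]) [] t2 t3 ts
    cases b
    · simp [applyAt, opX, opA] at h
      subst h
      have k3 := FF_assoc us [] t1 t2 (t3 :: ts)
      simp only [List.length_nil, zero_add] at k3
      rw [key, key, k2, k3, ← mul_assoc, ← mul_assoc, ← mul_assoc]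
      congr 1
      have := rel_pent (rr us.length)
      rw [← rr_succ] at this
      change aA us.length * aA us.length = aA (us.length + 1) * aA us.length * _ at this
      rw [eq_mul_inv_iff_mul_eq, eq_mul_inv_iff_mul_eq, mul_assoc, mul_assoc, this]
      group
    · simp [applyAt, opX, opS] at h
      subst h
      have k3 := FF_swap us [] t1 t2 (t3 :: ts) (by
        refine hn.sublist ?_
        simp only [lv, List.nil_append, ← List.append_assoc]
        exact List.sublist_append_left _ _)
      simp only [List.length_nil, zero_add] at k3
      rw [key, key, k2, k2, k3, ← mul_assoc, ← mul_assoc, ← mul_assoc, ← mul_assoc]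
      congr 1
      have := rel_SAA (rr us.length)
      rw [← rr_succ] at this
      change sS us.length * aA (us.length + 1) * aA us.length
        = aA (us.length + 1) * aA us.length * _ at this
      rw [eq_mul_inv_iff_mul_eq, eq_mul_inv_iff_mul_eq, mul_assoc, mul_assoc,
        ← mul_assoc (sS us.length), this]
      group
  | cons c β ih =>
    rcases t with _ | ⟨t1, t2⟩
    · cases c <;> simp [applyAt] at h
    · cases c
      · simp [applyAt] at h
        obtain ⟨s, hs, rfl⟩ := h
        have n1 : (lvs us ++ lv t1).Nodup := by
          refine hn.sublist ?_
          simp only [lv, ← List.append_assoc]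
          exact List.sublist_append_left _ _
        have i1 := ih us t1 s (t2 :: ts) n1 hs
          (fun x y => by simpa using FF_assoc us [] x y (t2 :: ts))
        rw [key, key, i1, ← mul_assoc, ← mul_assoc]
        congr 1
        have := rel_A0 (rr us.length) b β
        change _ * aA us.length = aA us.length * _ at this
        rw [eq_mul_inv_iff_mul_eq, mul_assoc, this, inv_mul_cancel_left]
      · simp [applyAt] at h
        obtain ⟨s, hs, rfl⟩ := h
        have n1 : (lvs (us ++ [t1]) ++ lv t2).Nodup := by
          simpa [lvs_append, lvs, lv] using hn
        have i1 := ih (us ++ [t1]) t2 s ts n1 hs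
          (fun x y => by simpa using FF_assoc (us ++ [t1]) [] x y ts)
        simp only [List.append_assoc, List.cons_append, List.nil_append, List.length_append,
          List.length_cons, List.length_nil, zero_add, rr_add us.length 1] at i1
        rw [key, key, i1, ← mul_assoc, ← mul_assoc]
        congr 1
        have := rel_A10 (rr us.length) b β
        change _ * aA us.length = aA us.length * _ at this
        rw [eq_mul_inv_iff_mul_eq, mul_assoc]
        exact (inv_mul_eq_iff_eq_mul.mpr this)

/-- The elements hanging on the right spine. -/
def spine : CTree → List CTree
  | .leaf _ => []
  | .node a b => a :: spine b

def NN (t : CTree) : PG := FF [] (spine t)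

theorem spine_sub (t : CTree) : (lvs (spine t)).Sublist (lv t) := by
  induction t with
  | leaf x => simp [spine, lvs]
  | node a b _ ih => simp only [spine, lvs, lv]; exact ih.append_left _

theorem FF_spine (b : Bool) (α : Addr) (us : List CTree) (t t' : CTree)
    (hn : (lvs us ++ lv t).Nodup) (h : applyAt α (opX b) t = some t') :
    FF [] (us ++ spine t) = pX b (rr us.length ++ α) * FF [] (us ++ spine t') := by
  induction α generalizing us t t' with
  | nil =>
    rcases t with _ | ⟨t1, _ | ⟨t2, t3⟩⟩
    · cases b <;> simp [applyAt, opX, opS, opA] at h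
    · cases b <;> simp [applyAt, opX, opS, opA] at h
    cases b
    · simp [applyAt, opX, opA] at h
      subst h
      have := FF_assoc us [] t1 t2 (spine t3)
      simp only [List.length_nil, zero_add] at this
      rw [List.append_nil, spine, spine, spine, this]
      exact (mul_inv_cancel_left _ _).symm
    · simp [applyAt, opX, opS] at h
      subst h
      have := FF_swap us [] t1 t2 (spine t3) (by
        refine hn.sublist ?_
        simp only [lv, List.nil_append, ← List.append_assoc]
        exact List.sublist_append_left _ _)
      simp only [List.length_nil, zero_add] at this
      rw [List.append_nil, spine, spine, spine, spine, this]
      rfl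
  | cons c α ih =>
    rcases t with _ | ⟨t1, t2⟩
    · cases c <;> simp [applyAt] at h
    · cases c
      · simp [applyAt] at h
        obtain ⟨s, hs, rfl⟩ := h
        refine FF_inner b α us t1 s (spine t2) ?_ hs
        refine hn.sublist ?_
        simp only [lv, ← List.append_assoc]
        exact List.sublist_append_left _ _
      · simp [applyAt] at h
        obtain ⟨s, hs, rfl⟩ := h
        have n1 : (lvs (us ++ [t1]) ++ lv t2).Nodup := by
          simpa [lvs_append, lvs, lv] using hn
        have i1 := ih (us ++ [t1]) t2 s n1 hs
        simp only [List.append_assoc, List.cons_append, List.nil_append, List.length_append,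
          List.length_cons, List.length_nil, zero_add, rr_add us.length 1] at i1
        exact i1

theorem NN_gen (b : Bool) (α : Addr) (t t' : CTree)
    (hn : (lv t).Nodup) (h : applyAt α (opX b) t = some t') :
    NN t = pX b α * NN t' :=
  FF_spine b α [] t t' hn h

/-! ### Partial maps -/

theorem pmul_apply (f g : PMap) (t : CTree) : (f * g) t = (f t).bind g := rfl
theorem pone_apply (t : CTree) : (1 : PMap) t = some t := rfl

theorem applyAt_mul (γ : Addr) (f g : PMap) :
    applyAt γ (f * g) = applyAt γ f * applyAt γ g := by
  induction γ with
  | nil => rfl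
  | cons c γ ih =>
    funext t
    cases c <;> rcases t with _ | ⟨t1, t2⟩ <;> simp only [applyAt, pmul_apply, ih]
    · rfl
    · cases h : applyAt γ f t1 <;> simp
    · rfl
    · cases h : applyAt γ f t2 <;> simp

theorem applyAt_append (γ δ : Addr) (f : PMap) :
    applyAt (γ ++ δ) f = applyAt γ (applyAt δ f) := by
  induction γ with
  | nil => rfl
  | cons c γ ih => cases c <;> simp only [List.cons_append, applyAt, ih]

theorem applyAt_some (γ : Addr) {f : PMap} (hf : ∃ t, (f t).isSome) :
    ∃ t, (applyAt γ f t).isSome := by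
  induction γ with
  | nil => exact hf
  | cons c γ ih =>
    obtain ⟨t, ht⟩ := ih
    cases c
    · exact ⟨.node t (.leaf 1), by simpa [applyAt] using ht⟩
    · exact ⟨.node (.leaf 1) t, by simpa [applyAt] using ht⟩

theorem NearEq.at {f g : PMap} (h : NearEq f g) (γ : Addr) :
    NearEq (applyAt γ f) (applyAt γ g) := by
  induction γ with
  | nil => exact h
  | cons c γ ih =>
    obtain ⟨⟨t, h1, h2⟩, h3⟩ := ih
    cases c
    · refine ⟨⟨.node t (.leaf 1), by simpa [applyAt] using h1, by simpa [applyAt] using h2⟩, ?_⟩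
      rintro (_ | ⟨t1, t2⟩) a b
      · rfl
      · simp only [applyAt, Option.isSome_map] at a b ⊢
        rw [h3 _ a b]
    · refine ⟨⟨.node (.leaf 1) t, by simpa [applyAt] using h1, by simpa [applyAt] using h2⟩, ?_⟩
      rintro (_ | ⟨t1, t2⟩) a b
      · rfl
      · simp only [applyAt, Option.isSome_map] at a b ⊢
        rw [h3 _ a b]

theorem NearEq.at_one {f : PMap} (h : NearEq f 1) (γ : Addr) :
    NearEq (applyAt γ f) 1 := by
  obtain ⟨⟨t, h1, h2⟩, h3⟩ := h.at γ
  refine ⟨⟨t, h1, rfl⟩, ?_⟩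
  have key : ∀ (γ : Addr) (t : CTree), (applyAt γ f t).isSome → applyAt γ f t = some t := by
    intro γ
    induction γ with
    | nil => intro t ht; exact h.2 t ht rfl
    | cons c γ ih =>
      rintro (_ | ⟨t1, t2⟩) ht
      · cases c <;> simp [applyAt] at ht
      · cases c <;> simp only [applyAt, Option.isSome_map] at ht ⊢ <;> rw [ih _ ht] <;> rfl
  intro t ht _
  exact key γ t ht

theorem opX_some (b : Bool) : ∃ t, (opX b t).isSome := by
  refine ⟨.node (.leaf 1) (.node (.leaf 1) (.leaf 1)), ?_⟩
  cases b <;> rfl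

/-- Swapping back. -/
theorem opAi_iff (α : Addr) (t t' : CTree) :
    applyAt α opAi t = some t' ↔ applyAt α opA t' = some t := by
  induction α generalizing t t' with
  | nil =>
    simp only [applyAt]
    constructor
    · intro h
      rcases t with _ | ⟨_ | ⟨t1, t2⟩, t3⟩ <;> simp [opAi] at h
      subst h; rfl
    · intro h
      rcases t' with _ | ⟨t1, _ | ⟨t2, t3⟩⟩ <;> simp [opA] at h
      subst h; rfl
  | cons c α ih =>
    rcases t with _ | ⟨t1, t2⟩ <;> rcases t' with _ | ⟨s1, s2⟩ <;> cases c <;>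
      simp [applyAt, ih, and_comm, eq_comm]

theorem opS_symm (α : Addr) (t t' : CTree) (h : applyAt α opS t = some t') :
    applyAt α opS t' = some t := by
  induction α generalizing t t' with
  | nil =>
    rcases t with _ | ⟨t1, _ | ⟨t2, t3⟩⟩ <;> simp [applyAt, opS] at h
    subst h; rfl
  | cons c α ih =>
    rcases t with _ | ⟨t1, t2⟩
    · cases c <;> simp [applyAt] at h
    · cases c <;> simp [applyAt] at h <;> obtain ⟨s, hs, rfl⟩ := h <;>
        simp [applyAt, ih _ _ hs]

def tmap (t : CTree) : CTree :=
  match t with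
  | .leaf _ => .leaf 1
  | .node a b => .node (tmap a) (tmap b)

/-- Equivariance under forgetting labels. -/
def Equi (f : PMap) : Prop := ∀ t, f (tmap t) = (f t).map tmap

theorem Equi.at {f : PMap} (h : Equi f) (α : Addr) : Equi (applyAt α f) := by
  induction α with
  | nil => exact h
  | cons c α ih =>
    rintro (_ | ⟨t1, t2⟩)
    · cases c <;> rfl
    · cases c <;> simp only [tmap, applyAt, ih _] <;> simp [Function.comp_def, tmap]

theorem Equi.mul {f g : PMap} (hf : Equi f) (hg : Equi g) : Equi (f * g) := by
  intro t
  rw [pmul_apply, pmul_apply, hf t]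
  cases f t with
  | none => rfl
  | some u => simpa using hg u

theorem equi_A : Equi opA := by
  rintro (_ | ⟨t1, _ | ⟨t2, t3⟩⟩) <;> rfl
theorem equi_S : Equi opS := by
  rintro (_ | ⟨t1, _ | ⟨t2, t3⟩⟩) <;> rfl
theorem equi_Ai : Equi opAi := by
  rintro (_ | ⟨_ | ⟨t1, t2⟩, t3⟩) <;> rfl

theorem exists_nodup (t : CTree) (n : ℕ) :
    ∃ u, tmap u = tmap t ∧ (lv u).Nodup ∧ ∀ x ∈ lv u, n < (x : ℕ) := by
  induction t generalizing n with
  | leaf x =>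
    refine ⟨.leaf ⟨n + 1, by omega⟩, rfl, List.nodup_singleton _, fun y hy => ?_⟩
    rw [List.mem_singleton.mp hy]
    exact Nat.lt_succ_self n
  | node a b iha ihb =>
    obtain ⟨u, hu, nu, lu⟩ := iha n
    have : ∃ m : ℕ, n ≤ m ∧ ∀ x ∈ lv u, (x : ℕ) ≤ m := by
      refine ⟨n + ((lv u).map PNat.val).sum, by omega, fun x hx => ?_⟩
      have := List.le_sum_of_mem (List.mem_map_of_mem (f := PNat.val) hx)
      exact this.trans (Nat.le_add_left _ _)
    obtain ⟨m, hm, hu2⟩ := this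
    obtain ⟨v, hv, nv, lv'⟩ := ihb m
    refine ⟨.node u v, by simp [tmap, hu, hv], ?_, ?_⟩
    · simp only [lv]
      refine List.Nodup.append nu nv ?_
      intro x h1 h2
      have := hu2 x h1
      have := lv' x h2
      omega
    · intro x hx
      simp only [lv, List.mem_append] at hx
      rcases hx with hx | hx
      · exact lu x hx
      · have := lv' x hx
        omega

/-- `f` implements the group element `w`. -/
def Impl (w : PG) (f : PMap) : Prop :=
  Equi f ∧ ∀ t t', (lv t).Nodup → f t = some t' → (lv t').Perm (lv t) ∧ NN t = w * NN t'

theorem Impl.mul {w w' : PG} {f f' : PMap} (h : Impl w f) (h' : Impl w' f') :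
    Impl (w * w') (f * f') := by
  refine ⟨h.1.mul h'.1, ?_⟩
  intro t t' hn ht
  rw [pmul_apply, Option.bind_eq_some_iff] at ht
  obtain ⟨u, hu, hu'⟩ := ht
  obtain ⟨p1, e1⟩ := h.2 t u hn hu
  obtain ⟨p2, e2⟩ := h'.2 u t' (p1.nodup_iff.mpr hn) hu'
  exact ⟨p2.trans p1, by rw [e1, e2, mul_assoc]⟩

theorem impl_one : Impl 1 1 := by
  refine ⟨fun t => rfl, ?_⟩
  intro t t' hn ht
  rw [pone_apply] at ht
  cases ht
  exact ⟨List.Perm.refl _, (one_mul _).symm⟩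

theorem impl_X (b : Bool) (α : Addr) : Impl (pX b α) (applyAt α (opX b)) := by
  refine ⟨Equi.at (by cases b; exacts [equi_A, equi_S]) α, ?_⟩
  intro t t' hn ht
  exact ⟨opX_perm ht, NN_gen b α t t' hn ht⟩

theorem impl_Ai (α : Addr) : Impl (pX false α)⁻¹ (applyAt α opAi) := by
  refine ⟨equi_Ai.at α, ?_⟩
  intro t t' hn ht
  rw [opAi_iff] at ht
  have p := opX_perm (b := false) ht
  refine ⟨p.symm, ?_⟩
  rw [NN_gen false α t' t (p.nodup_iff.mp hn) ht, inv_mul_cancel_left]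

theorem Impl.eq_one {w : PG} {f : PMap} (h : Impl w f) (hf : NearEq f 1) : w = 1 := by
  obtain ⟨⟨t, h1, -⟩, h3⟩ := hf
  obtain ⟨u, hu, nu, -⟩ := exists_nodup t 0
  have e1 := h.1 t
  have e2 := h.1 u
  have hs : (f u).isSome := by
    rw [hu, e1] at e2
    have := congrArg Option.isSome e2
    simp only [Option.isSome_map] at this
    rw [← this]; exact h1
  have := h3 u hs rfl
  have := (h.2 u u nu this).2
  exact (mul_eq_right.mp this.symm)

theorem nearEq_refl {f : PMap} (h : ∃ t, (f t).isSome) : NearEq f f := by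
  obtain ⟨t, ht⟩ := h
  exact ⟨⟨t, ht, ht⟩, fun _ _ _ => rfl⟩

/-- Near-equality from a case analysis. -/
theorem nearEq_of_eq {f g : PMap} (h : f = g) (h' : ∃ t, (f t).isSome) : NearEq f g := by
  subst h; exact nearEq_refl h'

/-- The three-leaf and four-leaf patterns make all relations visible at the root. -/
theorem near_comm {f g : PMap} (hf : ∃ t, (f t).isSome) (hg : ∃ t, (g t).isSome) :
    NearEq (applyAt [false] f * applyAt [true] g) (applyAt [true] g * applyAt [false] f) := by
  obtain ⟨t, ht⟩ := hf
  obtain ⟨u, hu⟩ := hg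
  obtain ⟨t', ht⟩ := Option.isSome_iff_exists.mp ht
  obtain ⟨u', hu⟩ := Option.isSome_iff_exists.mp hu
  refine nearEq_of_eq ?_ ⟨.node t u, by simp [pmul_apply, applyAt, ht, hu]⟩
  funext v
  rcases v with _ | ⟨a, b⟩
  · rfl
  · simp only [pmul_apply, applyAt]
    cases h1 : f a <;> cases h2 : g b <;> simp [applyAt, h1, h2]

theorem near_A11 {f : PMap} (hf : ∃ t, (f t).isSome) :
    NearEq (applyAt [true, true] f * opA) (opA * applyAt [true] f) := by
  obtain ⟨t, ht⟩ := hf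
  obtain ⟨t', ht⟩ := Option.isSome_iff_exists.mp ht
  refine nearEq_of_eq ?_ ⟨.node t (.node t t), by simp [pmul_apply, applyAt, ht, opA]⟩
  funext v
  rcases v with _ | ⟨a, _ | ⟨b, c⟩⟩
  · rfl
  · rfl
  · simp only [pmul_apply, applyAt, opA]
    cases h1 : f c <;> simp [applyAt, h1, opA]

theorem near_A10 {f : PMap} (hf : ∃ t, (f t).isSome) :
    NearEq (applyAt [true, false] f * opA) (opA * applyAt [false, true] f) := by
  obtain ⟨t, ht⟩ := hf
  obtain ⟨t', ht⟩ := Option.isSome_iff_exists.mp ht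
  refine nearEq_of_eq ?_ ⟨.node t (.node t t), by simp [pmul_apply, applyAt, ht, opA]⟩
  funext v
  rcases v with _ | ⟨a, _ | ⟨b, c⟩⟩
  · rfl
  · rfl
  · simp only [pmul_apply, applyAt, opA]
    cases h1 : f b <;> simp [applyAt, h1, opA]

theorem near_A0 {f : PMap} (hf : ∃ t, (f t).isSome) :
    NearEq (applyAt [false] f * opA) (opA * applyAt [false, false] f) := by
  obtain ⟨t, ht⟩ := hf
  obtain ⟨t', ht⟩ := Option.isSome_iff_exists.mp ht
  refine nearEq_of_eq ?_ ⟨.node t (.node t t), by simp [pmul_apply, applyAt, ht, opA]⟩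
  funext v
  rcases v with _ | ⟨a, _ | ⟨b, c⟩⟩
  · rfl
  · simp only [pmul_apply, applyAt, opA]
    cases h1 : f a <;> simp [opA]
  · simp only [pmul_apply, applyAt, opA]
    cases h1 : f a <;> simp [applyAt, h1, opA]

theorem near_S11 {f : PMap} (hf : ∃ t, (f t).isSome) :
    NearEq (applyAt [true, true] f * opS) (opS * applyAt [true, true] f) := by
  obtain ⟨t, ht⟩ := hf
  obtain ⟨t', ht⟩ := Option.isSome_iff_exists.mp ht
  refine nearEq_of_eq ?_ ⟨.node t (.node t t), by simp [pmul_apply, applyAt, ht, opS]⟩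
  funext v
  rcases v with _ | ⟨a, _ | ⟨b, c⟩⟩
  · rfl
  · rfl
  · simp only [pmul_apply, applyAt, opS]
    cases h1 : f c <;> simp [applyAt, h1, opS]

theorem near_S10 {f : PMap} (hf : ∃ t, (f t).isSome) :
    NearEq (applyAt [true, false] f * opS) (opS * applyAt [false] f) := by
  obtain ⟨t, ht⟩ := hf
  obtain ⟨t', ht⟩ := Option.isSome_iff_exists.mp ht
  refine nearEq_of_eq ?_ ⟨.node t (.node t t), by simp [pmul_apply, applyAt, ht, opS]⟩
  funext v
  rcases v with _ | ⟨a, _ | ⟨b, c⟩⟩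
  · rfl
  · rfl
  · simp only [pmul_apply, applyAt, opS]
    cases h1 : f b <;> simp [applyAt, h1, opS]

theorem near_S0 {f : PMap} (hf : ∃ t, (f t).isSome) :
    NearEq (applyAt [false] f * opS) (opS * applyAt [true, false] f) := by
  obtain ⟨t, ht⟩ := hf
  obtain ⟨t', ht⟩ := Option.isSome_iff_exists.mp ht
  refine nearEq_of_eq ?_ ⟨.node t (.node t t), by simp [pmul_apply, applyAt, ht, opS]⟩
  funext v
  rcases v with _ | ⟨a, _ | ⟨b, c⟩⟩
  · rfl
  · simp only [pmul_apply, applyAt, opS]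
    cases h1 : f a <;> simp [opS]
  · simp only [pmul_apply, applyAt, opS]
    cases h1 : f a <;> simp [applyAt, h1, opS]

/-- The tree `x(x(xx))` and `x((xx)x)`. -/
def tr4 : CTree := .node (.leaf 1) (.node (.leaf 1) (.node (.leaf 1) (.leaf 1)))
def tr4' : CTree := .node (.leaf 1) (.node (.node (.leaf 1) (.leaf 1)) (.leaf 1))

theorem near_pent : NearEq (opA * opA) (applyAt [true] opA * opA * applyAt [false] opA) := by
  refine ⟨⟨tr4, rfl, rfl⟩, ?_⟩
  rintro (_ | ⟨a, _ | ⟨b, _ | ⟨c, d⟩⟩⟩) h1 h2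
  all_goals first | rfl | simp [pmul_apply, applyAt, opA] at h1 h2

theorem near_SAA : NearEq (opS * applyAt [true] opA * opA)
    (applyAt [true] opA * opA * applyAt [false] opS) := by
  refine ⟨⟨tr4, rfl, rfl⟩, ?_⟩
  rintro (_ | ⟨a, _ | ⟨b, _ | ⟨c, d⟩⟩⟩) h1 h2
  all_goals first | rfl | simp [pmul_apply, applyAt, opA, opS] at h1 h2

theorem near_SSA1 : NearEq (applyAt [true] opS * opS * applyAt [true] opA) (opA * opS) := by
  refine ⟨⟨tr4, rfl, rfl⟩, ?_⟩
  rintro (_ | ⟨a, _ | ⟨b, _ | ⟨c, d⟩⟩⟩) h1 h2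
  all_goals first | rfl | simp [pmul_apply, applyAt, opA, opS] at h1 h2

theorem near_SSA : NearEq (opS * applyAt [true] opS * opA) (applyAt [true] opA * opS) := by
  refine ⟨⟨tr4, rfl, rfl⟩, ?_⟩
  rintro (_ | ⟨a, _ | ⟨b, _ | ⟨c, d⟩⟩⟩) h1 h2
  all_goals first | rfl | simp [pmul_apply, applyAt, opA, opS] at h1 h2

theorem near_braid : NearEq (opS * applyAt [true] opS * opS)
    (applyAt [true] opS * opS * applyAt [true] opS) := by
  refine ⟨⟨tr4, rfl, rfl⟩, ?_⟩
  rintro (_ | ⟨a, _ | ⟨b, _ | ⟨c, d⟩⟩⟩) h1 h2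
  all_goals first | rfl | simp [pmul_apply, applyAt, opA, opS] at h1 h2

theorem near_SS : NearEq (opS * opS) 1 := by
  refine ⟨⟨tr4, rfl, rfl⟩, ?_⟩
  rintro (_ | ⟨a, _ | ⟨b, c⟩⟩) h1 h2
  all_goals first | rfl | simp [pmul_apply, opS] at h1 h2

theorem near_AAi : NearEq (opA * opAi) 1 := by
  refine ⟨⟨tr4, rfl, rfl⟩, ?_⟩
  rintro (_ | ⟨a, _ | ⟨b, c⟩⟩) h1 h2
  all_goals first | rfl | simp [pmul_apply, opA] at h1 h2

theorem atX_some (b : Bool) (α : Addr) : ∃ t, (applyAt α (opX b) t).isSome :=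
  applyAt_some α (opX_some b)

theorem memX (b : Bool) (α : Addr) : applyAt α (opX b) ∈ GeoAS := by
  cases b
  exacts [memA α, memS α]

theorem memAi (α : Addr) : applyAt α opAi ∈ GeoAS :=
  Submonoid.subset_closure ⟨α, Or.inr (Or.inl rfl)⟩

def geoX (b : Bool) (α : Addr) : GeoAS := ⟨applyAt α (opX b), memX b α⟩

theorem geoX_val (b : Bool) (α : Addr) : (geoX b α).1 = applyAt α (opX b) := rfl

def toG {G : Type*} [Group G] (q : GeoAS →* G) : GenAS → G
  | .A α => q (geoX false α)
  | .S α => q (geoX true α)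

theorem lift_fX {G : Type*} [Group G] (q : GeoAS →* G) (b : Bool) (α : Addr) :
    FreeGroup.lift (toG q) (fX b α) = q (geoX b α) := by
  cases b <;> simp [fX, toG]

theorem applyAt_cons_eq (c : Bool) (α : Addr) (f : PMap) :
    applyAt (c :: α) f = applyAt [c] (applyAt α f) := applyAt_append [c] α f

theorem applyAt_cons2_eq (c d : Bool) (α : Addr) (f : PMap) :
    applyAt (c :: d :: α) f = applyAt [c, d] (applyAt α f) := applyAt_append [c, d] α f

theorem toG_rels {G : Type*} [Group G] (q : GeoAS →* G)
    (hiff : ∀ f g : GeoAS, q f = q g ↔ NearEq f.1 g.1) :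
    ∀ r ∈ relsAS, FreeGroup.lift (toG q) r = 1 := by
  have hA : ∀ γ, fA γ = fX false γ := fun _ => rfl
  have hS : ∀ γ, fS γ = fX true γ := fun _ => rfl
  rintro r ⟨γ, h⟩
  simp only [hA, hS] at h
  rcases h with ⟨b, b', α, β, rfl⟩ | ⟨b, α, rfl⟩ | ⟨b, α, rfl⟩ | ⟨b, α, rfl⟩ | ⟨b, α, rfl⟩ |
    ⟨b, α, rfl⟩ | ⟨b, α, rfl⟩ | rfl | rfl | rfl | rfl | rfl | rfl
  on_goal 13 =>
    simp only [map_mul, lift_fX]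
    rw [← map_mul, ← map_one q, hiff]
    simp only [Submonoid.coe_mul, geoX_val, ← applyAt_mul]
    exact near_SS.at_one γ
  all_goals
    rw [map_mul, map_inv, mul_inv_eq_one]
    simp only [map_mul, lift_fX]
    simp only [← map_mul]
    rw [hiff]
    simp only [Submonoid.coe_mul, geoX_val, applyAt_append, ← applyAt_mul]
    apply NearEq.at
  · rw [applyAt_cons_eq false, applyAt_cons_eq true]
    exact near_comm (atX_some b α) (atX_some b' β)
  · rw [applyAt_cons2_eq true, applyAt_cons_eq true]
    exact near_A11 (atX_some b α)
  · rw [applyAt_cons2_eq true, applyAt_cons2_eq false]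
    exact near_A10 (atX_some b α)
  · rw [applyAt_cons2_eq false, applyAt_cons_eq false α]
    exact near_A0 (atX_some b α)
  · rw [applyAt_cons2_eq true]
    exact near_S11 (atX_some b α)
  · rw [applyAt_cons2_eq true, applyAt_cons_eq false α]
    exact near_S10 (atX_some b α)
  · rw [applyAt_cons2_eq true, applyAt_cons_eq false α]
    exact near_S0 (atX_some b α)
  · exact near_pent
  · exact near_SAA
  · exact near_SSA1
  · exact near_SSA
  · exact near_braid

def canon {G : Type*} [Group G] (q : GeoAS →* G)
    (hiff : ∀ f g : GeoAS, q f = q g ↔ NearEq f.1 g.1) : PG →* G :=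
  PresentedGroup.toGroup (toG_rels q hiff)

theorem canon_X {G : Type*} [Group G] (q : GeoAS →* G)
    (hiff : ∀ f g : GeoAS, q f = q g ↔ NearEq f.1 g.1) (b : Bool) (α : Addr) :
    canon q hiff (pX b α) = q (geoX b α) := by
  cases b
  · exact PresentedGroup.toGroup.of (toG_rels q hiff) (x := GenAS.A α)
  · exact PresentedGroup.toGroup.of (toG_rels q hiff) (x := GenAS.S α)

theorem q_Ai {G : Type*} [Group G] (q : GeoAS →* G)
    (hiff : ∀ f g : GeoAS, q f = q g ↔ NearEq f.1 g.1) (α : Addr) :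
    q ⟨applyAt α opAi, memAi α⟩ = (q (geoX false α))⁻¹ := by
  symm
  rw [inv_eq_iff_mul_eq_one, ← map_mul, ← map_one q, hiff]
  simp only [Submonoid.coe_mul, geoX_val, opX, ← applyAt_mul]
  exact near_AAi.at_one α

theorem pX_inv_S (α : Addr) : (pX true α)⁻¹ = pX true α :=
  inv_eq_of_mul_eq_one_left (rel_SS α)

theorem exists_impl {G : Type*} [Group G] (q : GeoAS →* G)
    (hiff : ∀ f g : GeoAS, q f = q g ↔ NearEq f.1 g.1) (x : FreeGroup GenAS) :
    ∃ f : GeoAS, q f = canon q hiff (PresentedGroup.mk relsAS x) ∧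
      Impl (PresentedGroup.mk relsAS x) f.1 := by
  induction x using FreeGroup.induction_on with
  | C1 => exact ⟨1, by simp, by simpa using impl_one⟩
  | of x =>
    cases x with
    | A α => exact ⟨geoX false α, (canon_X q hiff false α).symm, impl_X false α⟩
    | S α => exact ⟨geoX true α, (canon_X q hiff true α).symm, impl_X true α⟩
  | inv_of x _ =>
    cases x with
    | A α =>
      refine ⟨⟨applyAt α opAi, memAi α⟩, ?_, ?_⟩
      · rw [map_inv, map_inv, q_Ai q hiff]
        exact congrArg _ (canon_X q hiff false α).symm
      · rw [map_inv]; exact impl_Ai α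
    | S α =>
      have h : PresentedGroup.mk relsAS (FreeGroup.of (GenAS.S α))⁻¹ = pX true α := by
        rw [map_inv]; exact pX_inv_S α
      refine ⟨geoX true α, ?_, ?_⟩
      · exact (canon_X q hiff true α).symm.trans (congrArg _ h.symm)
      · exact h.symm ▸ impl_X true α
  | mul x y hx hy =>
    obtain ⟨f, h1, h2⟩ := hx
    obtain ⟨g, h3, h4⟩ := hy
    refine ⟨f * g, ?_, ?_⟩
    · rw [map_mul, map_mul, map_mul, h1, h3]
    · rw [map_mul]; exact h2.mul h4

theorem canon_inj {G : Type*} [Group G] (q : GeoAS →* G)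
    (hiff : ∀ f g : GeoAS, q f = q g ↔ NearEq f.1 g.1) :
    Function.Injective (canon q hiff) := by
  rw [injective_iff_map_eq_one]
  intro w hw
  obtain ⟨x, rfl⟩ := PresentedGroup.mk_surjective relsAS w
  obtain ⟨f, h1, h2⟩ := exists_impl q hiff x
  rw [hw, ← map_one q, hiff] at h1
  exact h2.eq_one h1

theorem canon_surj {G : Type*} [Group G] (q : GeoAS →* G)
    (hsurj : Function.Surjective q)
    (hiff : ∀ f g : GeoAS, q f = q g ↔ NearEq f.1 g.1) :
    Function.Surjective (canon q hiff) := by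
  intro g
  obtain ⟨⟨f, hf⟩, rfl⟩ := hsurj g
  suffices H : q ⟨f, hf⟩ ∈ (canon q hiff).range from H
  refine Submonoid.closure_induction (motive := fun f hf => q ⟨f, hf⟩ ∈ (canon q hiff).range)
    ?_ ?_ ?_ hf
  · rintro f ⟨α, rfl | rfl | rfl⟩
    · exact ⟨pX false α, canon_X q hiff false α⟩
    · exact ⟨(pX false α)⁻¹, by rw [map_inv, canon_X]; exact (q_Ai q hiff α).symm⟩
    · exact ⟨pX true α, canon_X q hiff true α⟩
  · have : q 1 ∈ (canon q hiff).range := by rw [map_one]; exact one_mem _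
    exact this
  · intro x y hx hy h1 h2
    have := mul_mem h1 h2
    rw [← map_mul] at this
    exact this

end Helpers

/-- Proposition 4.4: the relations `R_AS` completed with the torsion relations
`S_α² = 1` make a presentation of the group `𝔖• = G(A,S)` — i.e. of any group `G`
obtained from the geometry monoid `𝒢(A,S)` by identifying near-equal elements —
in terms of the generators `A_α` and `S_α`. -/
theorem stmt16 (G : Type*) [Group G] (q : GeoAS →* G)
    (hsurj : Function.Surjective q)
    (hiff : ∀ f g : GeoAS, q f = q g ↔ NearEq f.1 g.1) :
    ∃ iso : PresentedGroup relsAS ≃* G,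
      ∀ α : Addr,
        iso (PresentedGroup.of (GenAS.A α)) = q ⟨applyAt α opA, memA α⟩ ∧
        iso (PresentedGroup.of (GenAS.S α)) = q ⟨applyAt α opS, memS α⟩ := by
  refine ⟨MulEquiv.ofBijective (canon q hiff) ⟨canon_inj q hiff, canon_surj q hsurj hiff⟩, ?_⟩
  intro α
  exact ⟨canon_X q hiff false α, canon_X q hiff true α⟩
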